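/- arXiv:2209.07286 — 2 statements merged into one kernel-verified Lean document; each statement's English description precedes it below -/
import Mathlib

section
/- Let (M,J,g,ω) be a compact almost Hermitian manifold. If the first Betti number satisfies b^1 = 1, then h^{1,0}_d = 0. -/
/-!
Abstract framework for almost complex Hodge theory.

We model the bigraded algebra of complex valued smooth differential forms on a
compact almost complex manifold `(M, J)` of real dimension `2 n` by the
structure `ACForms n A`: a complex vector space `A` (the space of all complex
valued forms) with the spaces `Apq p q` of `(p,q)`-forms, the exterior
differential `d` with its bidegree components `μ + ∂ + ∂̄ + μ̄`, complex
conjugation, the wedge product, and integration over the (compact) manifold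
(with Stokes' theorem `integral_d`).

A Hermitian metric is modelled by the structure `ACMetric`: the associated
complex linear Hodge star operator, the fundamental form `ω`, the positivity
and nondegeneracy of the induced `L²` pairing, the formal adjoints of the
components of `d`, and the finite dimensionality (ellipticity on a compact
manifold) of the spaces of harmonic forms.
-/

/-- The bigraded algebra of complex valued smooth differential forms on a compact
almost complex manifold of real dimension `2 n`, with the operators of almost
complex geometry. -/
structure ACForms (n : ℕ) (A : Type) [AddCommGroup A] [Module ℂ A] : Type where
  /-- the subspace of forms of pure bidegree `(p,q)` -/
  Apq : ℤ → ℤ → Submodule ℂ A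
  Apq_bot : ∀ p q : ℤ, p < 0 ∨ q < 0 ∨ (n : ℤ) < p ∨ (n : ℤ) < q → Apq p q = ⊥
  /-- the exterior differential -/
  d : A →ₗ[ℂ] A
  /-- the `(+2,-1)` component `μ` of `d` -/
  mu : A →ₗ[ℂ] A
  /-- the `(+1,0)` component `∂` of `d` -/
  partialOp : A →ₗ[ℂ] A
  /-- the `(0,+1)` component `∂̄` of `d` -/
  dbar : A →ₗ[ℂ] A
  /-- the `(-1,+2)` component `μ̄` of `d` -/
  mubar : A →ₗ[ℂ] A
  d_decomp : d = mu + partialOp + dbar + mubar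
  mu_mem : ∀ (p q : ℤ) (α : A), α ∈ Apq p q → mu α ∈ Apq (p + 2) (q - 1)
  partial_mem : ∀ (p q : ℤ) (α : A), α ∈ Apq p q → partialOp α ∈ Apq (p + 1) q
  dbar_mem : ∀ (p q : ℤ) (α : A), α ∈ Apq p q → dbar α ∈ Apq p (q + 1)
  mubar_mem : ∀ (p q : ℤ) (α : A), α ∈ Apq p q → mubar α ∈ Apq (p - 1) (q + 2)
  d_d : ∀ α : A, d (d α) = 0
  /-- complex conjugation of forms (a conjugate linear involution) -/
  conj : A →+ A
  conj_smul : ∀ (c : ℂ) (α : A), conj (c • α) = starRingEnd ℂ c • conj α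
  conj_conj : ∀ α : A, conj (conj α) = α
  conj_mem : ∀ (p q : ℤ) (α : A), α ∈ Apq p q → conj α ∈ Apq q p
  conj_d : ∀ α : A, conj (d α) = d (conj α)
  /-- the wedge product -/
  wedge : A →ₗ[ℂ] A →ₗ[ℂ] A
  wedge_mem : ∀ (p q r s : ℤ) (α β : A), α ∈ Apq p q → β ∈ Apq r s →
    wedge α β ∈ Apq (p + r) (q + s)
  wedge_assoc : ∀ α β γ : A, wedge (wedge α β) γ = wedge α (wedge β γ)
  conj_wedge : ∀ α β : A, conj (wedge α β) = wedge (conj α) (conj β)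
  /-- the constant function `1`, viewed as a `(0,0)`-form -/
  one : A
  one_mem : one ∈ Apq 0 0
  one_wedge : ∀ α : A, wedge one α = α
  wedge_one : ∀ α : A, wedge α one = α
  conj_one : conj one = one
  d_one : d one = 0
  /-- Leibniz rule: for `α` of pure degree `k`,
  `d (α ∧ β) = dα ∧ β + (-1)^k α ∧ dβ` -/
  d_wedge : ∀ (k : ℤ) (α : A), α ∈ (⨆ p : ℤ, Apq p (k - p)) → ∀ β : A,
    d (wedge α β) = wedge (d α) β + ((-1 : ℂ) ^ k) • wedge α (d β)
  /-- integration over the compact manifold (nonzero only on top degree forms) -/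
  integral : A →ₗ[ℂ] ℂ
  /-- Stokes' theorem on a compact manifold -/
  integral_d : ∀ α : A, integral (d α) = 0
  integral_conj : ∀ α : A, integral (conj α) = starRingEnd ℂ (integral α)

namespace ACForms

variable {n : ℕ} {A : Type} [AddCommGroup A] [Module ℂ A] (M : ACForms n A)

/-- The space of forms of pure total degree `k`. -/
def Ak (k : ℤ) : Submodule ℂ A := ⨆ p : ℤ, M.Apq p (k - p)

/-- `J` is integrable iff its Nijenhuis tensor vanishes, iff `μ̄ = 0`. -/
def Integrable : Prop := M.mubar = 0

/-- A form is exact. -/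
def IsExact (α : A) : Prop := ∃ β : A, M.d β = α

/-- The space of `d`-closed `(p,q)`-forms. -/
def Zpq (p q : ℤ) : Submodule ℂ A := M.Apq p q ⊓ LinearMap.ker M.d

/-- The space of `d`-closed `k`-forms. -/
def Zk (k : ℤ) : Submodule ℂ A := M.Ak k ⊓ LinearMap.ker M.d

/-- `H^{p,q}_J(M) = {[α] ∈ H^{p+q}_dR(M;ℂ) | α ∈ A^{p,q}_J(M)}`, realised as the
quotient of the closed `(p,q)`-forms by the exact ones among them. -/
noncomputable def hJ (p q : ℤ) : ℕ :=
  Module.finrank ℂ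
    (↥(M.Zpq p q) ⧸ Submodule.comap (M.Zpq p q).subtype (LinearMap.range M.d ⊓ M.Zpq p q))

/-- The `k`-th (complex) Betti number `b^k = dim_ℂ H^k_dR(M;ℂ)`. -/
noncomputable def betti (k : ℤ) : ℕ :=
  Module.finrank ℂ
    (↥(M.Zk k) ⧸ Submodule.comap (M.Zk k).subtype (LinearMap.range M.d ⊓ M.Zk k))

/-- The `J`-invariant `2k`-forms: sums of `(k+j, k-j)`-forms with `j` even. -/
def AJplus (k : ℤ) : Submodule ℂ A := ⨆ j : ℤ, M.Apq (k + 2 * j) (k - 2 * j)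

/-- The `J`-anti-invariant `2k`-forms: sums of `(k+j, k-j)`-forms with `j` odd. -/
def AJminus (k : ℤ) : Submodule ℂ A := ⨆ j : ℤ, M.Apq (k + 2 * j + 1) (k - 2 * j - 1)

end ACForms

/-- A Hermitian metric on the compact almost complex manifold underlying
`M : ACForms n A`, described through its complex linear Hodge star operator,
its fundamental `(1,1)`-form `ω`, the induced positive definite `L²` pairing
`(α, β) ↦ ∫ α ∧ *(conj β)`, the formal adjoints of `d, μ, ∂, ∂̄, μ̄`, and finite
dimensionality of the spaces of harmonic forms. -/
structure ACMetric {n : ℕ} {A : Type} [AddCommGroup A] [Module ℂ A]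
    (M : ACForms n A) : Type where
  /-- the complex linear Hodge star operator -/
  star : A →ₗ[ℂ] A
  star_mem : ∀ (p q : ℤ) (α : A), α ∈ M.Apq p q →
    star α ∈ M.Apq ((n : ℤ) - q) ((n : ℤ) - p)
  star_star : ∀ (k : ℤ) (α : A), α ∈ M.Ak k →
    star (star α) = ((-1 : ℂ) ^ (k * (2 * (n : ℤ) - k))) • α
  star_conj : ∀ α : A, star (M.conj α) = M.conj (star α)
  /-- the fundamental form `ω(X,Y) = g(JX,Y)` -/
  omega : A
  omega_mem : omega ∈ M.Apq 1 1
  omega_real : M.conj omega = omega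
  /-- positivity of the `L²` pairing -/
  inner_self_im : ∀ α : A, (M.integral (M.wedge α (star (M.conj α)))).im = 0
  inner_self_nonneg : ∀ α : A, 0 ≤ (M.integral (M.wedge α (star (M.conj α)))).re
  inner_self_eq_zero : ∀ (k : ℤ) (α : A), α ∈ M.Ak k →
    M.integral (M.wedge α (star (M.conj α))) = 0 → α = 0
  /-- the formal adjoint `d*` of `d` -/
  dAdj : A →ₗ[ℂ] A
  /-- the formal adjoint `μ*` of `μ` -/
  muAdj : A →ₗ[ℂ] A
  /-- the formal adjoint `∂*` of `∂` -/
  partialAdj : A →ₗ[ℂ] A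
  /-- the formal adjoint `∂̄*` of `∂̄` -/
  dbarAdj : A →ₗ[ℂ] A
  /-- the formal adjoint `μ̄*` of `μ̄` -/
  mubarAdj : A →ₗ[ℂ] A
  dAdj_adjoint : ∀ α β : A,
    M.integral (M.wedge (M.d α) (star (M.conj β))) =
      M.integral (M.wedge α (star (M.conj (dAdj β))))
  muAdj_adjoint : ∀ α β : A,
    M.integral (M.wedge (M.mu α) (star (M.conj β))) =
      M.integral (M.wedge α (star (M.conj (muAdj β))))
  partialAdj_adjoint : ∀ α β : A,
    M.integral (M.wedge (M.partialOp α) (star (M.conj β))) =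
      M.integral (M.wedge α (star (M.conj (partialAdj β))))
  dbarAdj_adjoint : ∀ α β : A,
    M.integral (M.wedge (M.dbar α) (star (M.conj β))) =
      M.integral (M.wedge α (star (M.conj (dbarAdj β))))
  mubarAdj_adjoint : ∀ α β : A,
    M.integral (M.wedge (M.mubar α) (star (M.conj β))) =
      M.integral (M.wedge α (star (M.conj (mubarAdj β))))
  /-- on a compact manifold the spaces of harmonic forms are finite dimensional -/
  harmonic_finite : ∀ p q : ℤ,
    Module.Finite ℂ
      ↥(M.Apq p q ⊓ LinearMap.ker M.d ⊓ (LinearMap.ker M.d).comap star)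

namespace ACMetric

variable {n : ℕ} {A : Type} [AddCommGroup A] [Module ℂ A] {M : ACForms n A}
  (g : ACMetric M)

/-- The `L²` Hermitian inner product `(α, β) = ∫_M g(α,β) ω^n/n! = ∫_M α ∧ *(conj β)`. -/
def innerL2 (α β : A) : ℂ := M.integral (M.wedge α (g.star (M.conj β)))

/-- The squared `L²` norm. -/
noncomputable def normSq (α : A) : ℝ := (g.innerL2 α α).re

/-- The space `𝓗^{p,q}_d` of `d`-harmonic `(p,q)`-forms:
`α ∈ A^{p,q}_J` with `dα = 0` and `d(*α) = 0`. -/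
def Hd (p q : ℤ) : Submodule ℂ A :=
  M.Apq p q ⊓ LinearMap.ker M.d ⊓ (LinearMap.ker M.d).comap g.star

/-- The space `𝓗^{p,q}_∂̄` of `∂̄`-harmonic `(p,q)`-forms:
`α ∈ A^{p,q}_J` with `∂̄α = 0` and `∂(*α) = 0`. -/
def Hdbar (p q : ℤ) : Submodule ℂ A :=
  M.Apq p q ⊓ LinearMap.ker M.dbar ⊓ (LinearMap.ker M.partialOp).comap g.star

/-- `h^{p,q}_d = dim_ℂ 𝓗^{p,q}_d`. -/
noncomputable def hd (p q : ℤ) : ℕ := Module.finrank ℂ ↥(g.Hd p q)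

/-- `h^{p,q}_∂̄ = dim_ℂ 𝓗^{p,q}_∂̄`. -/
noncomputable def hdbar (p q : ℤ) : ℕ := Module.finrank ℂ ↥(g.Hdbar p q)

/-- The metric is almost Kähler if its fundamental form is closed. -/
def AlmostKahler : Prop := M.d g.omega = 0

end ACMetric

namespace ACForms

variable {n : ℕ} {A : Type} [AddCommGroup A] [Module ℂ A] (M : ACForms n A)

theorem mem_Ak_of_mem_Apq {p q k : ℤ} (h : p + q = k) {α : A} (hα : α ∈ M.Apq p q) :
    α ∈ M.Ak k := by
  obtain rfl : q = k - p := by lia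
  exact Submodule.mem_iSup_of_mem p hα

theorem conj_mem_Ak {k : ℤ} {α : A} (hα : α ∈ M.Ak k) : M.conj α ∈ M.Ak k := by
  refine Submodule.iSup_induction _ (motive := fun x => M.conj x ∈ M.Ak k) hα ?_ ?_ ?_
  · exact fun p x hx => M.mem_Ak_of_mem_Apq (by lia) (M.conj_mem _ _ _ hx)
  · simp
  · intro x y hx hy
    rw [map_add]
    exact add_mem hx hy

theorem integral_wedge_d_eq_zero {k : ℤ} {γ : A} (hγ : γ ∈ M.Ak k) (hd : M.d γ = 0) (β : A) :
    M.integral (M.wedge γ (M.d β)) = 0 := by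
  have h := M.integral_d (M.wedge γ β)
  rw [M.d_wedge k γ hγ, hd, map_zero, LinearMap.zero_apply, zero_add, map_smul,
    smul_eq_zero] at h
  exact h.resolve_left (zpow_ne_zero _ (by norm_num))

end ACForms

namespace ACMetric

variable {n : ℕ} {A : Type} [AddCommGroup A] [Module ℂ A] {M : ACForms n A}
  (g : ACMetric M)

theorem star_mem_Ak {k : ℤ} {α : A} (hα : α ∈ M.Ak k) : g.star α ∈ M.Ak (2 * n - k) := by
  refine Submodule.iSup_induction _ (motive := fun x => g.star x ∈ M.Ak (2 * n - k)) hα ?_ ?_ ?_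
  · exact fun p x hx => M.mem_Ak_of_mem_Apq (by lia) (g.star_mem _ _ _ hx)
  · simp
  · intro x y hx hy
    rw [map_add]
    exact add_mem hx hy

theorem eq_zero_of_star_eq_zero {k : ℤ} {α : A} (hα : α ∈ M.Ak k) (h : g.star α = 0) :
    α = 0 := by
  have h' := g.star_star k α hα
  rw [h, map_zero, eq_comm, smul_eq_zero] at h'
  exact h'.resolve_left (zpow_ne_zero _ (by norm_num))

/-- A coclosed form of pure degree which is exact vanishes. The primitive is not assumed to be
of pure degree. -/
theorem eq_zero_of_coclosed_of_exact {k : ℤ} {η : A} (hη : η ∈ M.Ak k)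
    (hstar : M.d (g.star η) = 0) (hex : M.IsExact η) : η = 0 := by
  obtain ⟨β, hβ⟩ := hex
  have hγ := g.star_mem_Ak (M.conj_mem_Ak hη)
  have hdγ : M.d (g.star (M.conj η)) = 0 := by
    rw [g.star_conj, ← M.conj_d, hstar, map_zero]
  have h0 := M.integral_wedge_d_eq_zero hγ hdγ β
  rw [hβ] at h0
  have hγ0 : g.star (M.conj η) = 0 := by
    refine g.inner_self_eq_zero _ _ hγ ?_
    rw [← g.star_conj, M.conj_conj, g.star_star k η hη, map_smul, map_smul, h0, smul_zero]
  have hc := g.eq_zero_of_star_eq_zero (M.conj_mem_Ak hη) hγ0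
  rw [← M.conj_conj η, hc, map_zero]

/-- A `(1,0)`-form which is proportional to its conjugate vanishes. -/
theorem eq_zero_of_conj_eq_smul (g : ACMetric M) {α : A} (hα : α ∈ M.Apq 1 0) {c : ℂ}
    (h : M.conj α = c • α) : α = 0 := by
  refine g.inner_self_eq_zero 1 α (M.mem_Ak_of_mem_Apq (by lia) hα) ?_
  have hw := M.wedge_mem _ _ _ _ _ _ hα (g.star_mem _ _ _ hα)
  rw [M.Apq_bot _ _ (by lia), Submodule.mem_bot] at hw
  rw [h, map_smul, map_smul, hw, smul_zero, map_zero]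

end ACMetric

/-- Let `(M,J,g,ω)` be a compact almost Hermitian manifold.
If the first Betti number satisfies `b¹ = 1`, then `h^{1,0}_d = 0`. -/
theorem hd_10_eq_zero_of_b1_eq_one
    {n : ℕ} {A : Type} [AddCommGroup A] [Module ℂ A]
    (M : ACForms n A) (g : ACMetric M) (hb : M.betti 1 = 1) :
    g.hd 1 0 = 0 := by
  suffices h : g.Hd 1 0 = ⊥ by rw [ACMetric.hd, h, finrank_bot]
  rw [Submodule.eq_bot_iff]
  rintro α ⟨⟨hα, hd⟩, hs⟩
  replace hd : M.d α = 0 := hd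
  replace hs : M.d (g.star α) = 0 := hs
  have hα1 : α ∈ M.Ak 1 := M.mem_Ak_of_mem_Apq (by lia) hα
  have hc1 := M.conj_mem_Ak hα1
  have hcd : M.d (M.conj α) = 0 := by rw [← M.conj_d, hd, map_zero]
  have hcs : M.d (g.star (M.conj α)) = 0 := by rw [g.star_conj, ← M.conj_d, hs, map_zero]
  by_contra hne
  let a : M.Zk 1 := ⟨α, hα1, hd⟩
  let b : M.Zk 1 := ⟨M.conj α, hc1, hcd⟩
  let E := Submodule.comap (M.Zk 1).subtype (LinearMap.range M.d ⊓ M.Zk 1)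
  have ha : E.mkQ a ≠ 0 := fun h0 => by
    rw [Submodule.mkQ_apply, Submodule.Quotient.mk_eq_zero] at h0
    exact hne (g.eq_zero_of_coclosed_of_exact hα1 hs h0.1)
  obtain ⟨c, hc⟩ := (finrank_eq_one_iff_of_nonzero' (E.mkQ a) ha).1 hb (E.mkQ b)
  rw [← map_smul, Submodule.mkQ_apply, Submodule.mkQ_apply, eq_comm,
    Submodule.Quotient.eq] at hc
  have hex : M.IsExact (M.conj α - c • α) := hc.1
  have hz := g.eq_zero_of_coclosed_of_exact
    (sub_mem hc1 (Submodule.smul_mem _ c hα1)) (by simp [hs, hcs]) hex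
  exact hne (g.eq_zero_of_conj_eq_smul hα (sub_eq_zero.1 hz))
end

section
/- Let (M,J,g) be a 4n-dimensional compact almost Hermitian manifold. Then H^{2n}_{g+,J+} ∩ H^{2n}_{g+,J−} = {[0]} and H^{2n}_{g−,J+} ∩ H^{2n}_{g−,J−} = {[0]}. -/
namespace ACForms

/-- The wedge product of a `J`-invariant and a `J`-anti-invariant form of middle degree vanishes,
for bidegree reasons. -/
theorem wedge_eq_zero_of_mem_AJplus_of_mem_AJminus
    {n : ℕ} {A : Type} [AddCommGroup A] [Module ℂ A] (M : ACForms (2 * n) A) {α β : A}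
    (hα : α ∈ M.AJplus n) (hβ : β ∈ M.AJminus n) : M.wedge α β = 0 := by
  refine Submodule.iSup_induction _ (motive := fun α => M.wedge α β = 0) hα
    (fun i α hα => ?_) (by simp) (fun x y hx hy => by simp [hx, hy])
  refine Submodule.iSup_induction _ (motive := fun β => M.wedge α β = 0) hβ
    (fun j β hβ => ?_) (by simp) (fun x y hx hy => by simp [hx, hy])
  have h := M.wedge_mem _ _ _ _ α β hα hβ
  rw [M.Apq_bot _ _ (by push_cast; omega)] at h
  exact (Submodule.mem_bot ℂ).1 h

/-- The wedge product of a closed form of pure degree with an exact form integrates to zero. -/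
theorem integral_wedge_d_eq_zero_s17
    {n : ℕ} {A : Type} [AddCommGroup A] [Module ℂ A] (M : ACForms n A) {k : ℤ} {α : A}
    (hα : α ∈ M.Ak k) (hd : M.d α = 0) (γ : A) : M.integral (M.wedge α (M.d γ)) = 0 := by
  have h := M.integral_d (M.wedge α γ)
  rw [M.d_wedge k α hα γ, hd] at h
  simpa [zpow_ne_zero] using h

end ACForms

/-- Let `(M,J,g)` be a `4n`-dimensional compact almost
Hermitian manifold. Then `H^{2n}_{g+,J+} ∩ H^{2n}_{g+,J-} = {[0]}` and
`H^{2n}_{g-,J+} ∩ H^{2n}_{g-,J-} = {[0]}`: if a real de Rham class of degree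
`2n` is represented both by a closed real `2n`-form `α'` with `*α' = ±α'` and
`Jα' = α'`, and by a closed real `2n`-form `α''` with `*α'' = ±α''` (same sign)
and `Jα'' = -α''`, then the class is zero, i.e. both representatives are exact. -/
theorem middle_degree_pureness
    {n : ℕ} {A : Type} [AddCommGroup A] [Module ℂ A]
    (M : ACForms (2 * n) A) (g : ACMetric M) :
    ∀ ε : ℝ, (ε = 1 ∨ ε = -1) →
    ∀ α' α'' : A,
      α' ∈ M.Ak (2 * n) → α'' ∈ M.Ak (2 * n) →
      M.conj α' = α' → M.conj α'' = α'' →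
      M.d α' = 0 → M.d α'' = 0 →
      g.star α' = (ε : ℂ) • α' → g.star α'' = (ε : ℂ) • α'' →
      α' ∈ M.AJplus (n : ℤ) → α'' ∈ M.AJminus (n : ℤ) →
      (∃ γ : A, M.conj γ = γ ∧ M.d γ = α' - α'') →
      (∃ γ : A, M.conj γ = γ ∧ M.d γ = α') ∧
        (∃ γ : A, M.conj γ = γ ∧ M.d γ = α'') := by
  intro ε _ α' α'' hα' _ hr _ hd _ hs _ hp hm ⟨γ, hγr, hγ⟩
  have hsq : M.integral (M.wedge α' α') = 0 := by
    have hsub : α' = α'' + M.d γ := by rw [hγ]; abel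
    calc M.integral (M.wedge α' α') = M.integral (M.wedge α' (α'' + M.d γ)) := by rw [← hsub]
      _ = 0 := by
        rw [map_add, map_add, M.wedge_eq_zero_of_mem_AJplus_of_mem_AJminus hp hm,
          M.integral_wedge_d_eq_zero_s17 hα' hd, map_zero, add_zero]
  have hzero : α' = 0 := g.inner_self_eq_zero _ α' hα' (by rw [hr, hs]; simp [hsq])
  exact ⟨⟨0, by simp [hzero]⟩, ⟨-γ, by simp [hγr], by simp [hγ, hzero]⟩⟩
end
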